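/- The function g₁(x) = ln(1 + x) − e^{1/x} Γ(0, 1/x) is monotonically increasing on (0, ∞), where Γ(0, z) = ∫_z^∞ t^{-1} e^{-t} dt. -/

import Mathlib

open Real MeasureTheory

/-- The upper incomplete gamma function at first argument `0`:
`Γ(0, z) = ∫ t in (z, ∞), t⁻¹ e^{-t} dt`, i.e. the exponential integral `E₁(z)`. -/
noncomputable def Gamma0 (z : ℝ) : ℝ := ∫ t in Set.Ioi z, t⁻¹ * Real.exp (-t)

theorem integrableOn_inv_mul_exp_neg_Ioi {z : ℝ} (hz : 0 < z) :
    IntegrableOn (fun t : ℝ => t⁻¹ * Real.exp (-t)) (Set.Ioi z) := by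
  refine Integrable.mono' ((integrableOn_exp_neg_Ioi z).const_mul z⁻¹)
    (by fun_prop) ?_
  filter_upwards [ae_restrict_mem measurableSet_Ioi] with t ht
  have ht' : z < t := ht
  have h0 : 0 < t := hz.trans ht'
  rw [Real.norm_of_nonneg (by positivity)]
  gcongr

theorem hasDerivAt_Gamma0 {z : ℝ} (hz : 0 < z) :
    HasDerivAt Gamma0 (-(z⁻¹ * Real.exp (-z))) z := by
  have hI : HasDerivAt (fun w => ∫ t in z..w, t⁻¹ * Real.exp (-t)) (z⁻¹ * Real.exp (-z)) z :=
    intervalIntegral.integral_hasDerivAt_right (by simp)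
      (Measurable.stronglyMeasurable (by fun_prop)).stronglyMeasurableAtFilter
      ((continuousAt_inv₀ hz.ne').mul (by fun_prop))
  refine (hI.const_sub (Gamma0 z)).congr_of_eventuallyEq ?_
  filter_upwards [lt_mem_nhds hz] with w hw
  rw [← intervalIntegral.integral_Ioi_sub_Ioi' (integrableOn_inv_mul_exp_neg_Ioi hz)
    (integrableOn_inv_mul_exp_neg_Ioi hw)]
  simp [Gamma0]

/-- The classical lower bound `e^{-z} / (z + 1) ≤ E₁(z)`. -/
theorem exp_neg_div_add_one_le_Gamma0 {z : ℝ} (hz : 0 < z) :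
    Real.exp (-z) / (z + 1) ≤ Gamma0 z := by
  have hderiv : ∀ t ∈ Set.Ici z, HasDerivAt (fun t : ℝ => -(Real.exp (-t) / (t + 1)))
      (Real.exp (-t) * (t + 2) / (t + 1) ^ 2) t := by
    intro t ht
    have h0 : 0 < t := hz.trans_le ht
    have h := ((hasDerivAt_neg t).exp.div ((hasDerivAt_id t).add_const 1)
      (by simp only [id]; positivity)).neg
    refine h.congr_deriv ?_
    simp only [id]
    ring
  have hnonneg : ∀ t ∈ Set.Ioi z, 0 ≤ Real.exp (-t) * (t + 2) / (t + 1) ^ 2 := by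
    intro t ht
    have h0 : 0 < t := hz.trans ht
    positivity
  have hlim : Filter.Tendsto (fun t : ℝ => -(Real.exp (-t) / (t + 1))) Filter.atTop (nhds 0) := by
    simpa using (Real.tendsto_exp_neg_atTop_nhds_zero.div_atTop
      (Filter.tendsto_atTop_add_const_right _ 1 Filter.tendsto_id)).neg
  have hint := integral_Ioi_of_hasDerivAt_of_nonneg' hderiv hnonneg hlim
  calc Real.exp (-z) / (z + 1)
      = ∫ t in Set.Ioi z, Real.exp (-t) * (t + 2) / (t + 1) ^ 2 := by rw [hint]; ring
    _ ≤ Gamma0 z := by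
      refine setIntegral_mono_on (integrableOn_Ioi_deriv_of_nonneg' hderiv hnonneg hlim)
        (integrableOn_inv_mul_exp_neg_Ioi hz) measurableSet_Ioi fun t ht => ?_
      have h0 : 0 < t := hz.trans ht
      rw [mul_div_assoc, mul_comm]
      gcongr
      rw [inv_eq_one_div, div_le_div_iff₀ (by positivity) h0]
      nlinarith

/-- The function of the main theorem, in the variable `z = 1 / x`. -/
theorem antitoneOn_log_sub_exp_mul_Gamma0 :
    AntitoneOn (fun z : ℝ => Real.log (1 + z) - Real.log z - Real.exp z * Gamma0 z)
      (Set.Ioi 0) := by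
  have hderiv : ∀ z ∈ Set.Ioi (0 : ℝ),
      HasDerivAt (fun z : ℝ => Real.log (1 + z) - Real.log z - Real.exp z * Gamma0 z)
        (1 / (1 + z) - z⁻¹
          - (Real.exp z * Gamma0 z + Real.exp z * -(z⁻¹ * Real.exp (-z)))) z := by
    intro z hz
    have h0 : 0 < z := hz
    exact ((((hasDerivAt_id z).const_add 1).log (by simp only [id]; positivity)).sub
      (Real.hasDerivAt_log h0.ne')).sub ((Real.hasDerivAt_exp z).mul (hasDerivAt_Gamma0 h0))
  refine antitoneOn_of_hasDerivWithinAt_nonpos (convex_Ioi 0)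
    (fun z hz => (hderiv z hz).continuousAt.continuousWithinAt)
    (fun z hz => (hderiv z (interior_subset hz)).hasDerivWithinAt) fun z hz => ?_
  have h0 : 0 < z := interior_subset hz
  have hexp : Real.exp z * Real.exp (-z) = 1 := by rw [← Real.exp_add]; simp
  have hbound : 1 / (1 + z) ≤ Real.exp z * Gamma0 z :=
    calc 1 / (1 + z) = Real.exp z * (Real.exp (-z) / (z + 1)) := by
          rw [← mul_div_assoc, hexp, add_comm]
      _ ≤ _ := by gcongr; exact exp_neg_div_add_one_le_Gamma0 h0
  linear_combination hbound + z⁻¹ * hexp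

/-- The function `g₁(x) = ln(1 + x) − e^{1/x} Γ(0, 1/x)` is monotonically increasing
on `(0, ∞)`. -/
theorem monotoneOn_log_sub_expGamma0 :
    MonotoneOn (fun x : ℝ => Real.log (1 + x) - Real.exp (1 / x) * Gamma0 (1 / x))
      (Set.Ioi 0) := by
  intro x hx y hy hxy
  have hx0 : 0 < x := hx
  have hy0 : 0 < y := hy
  have hlog : ∀ w : ℝ, 0 < w → Real.log (1 + w) = Real.log (1 + 1 / w) - Real.log (1 / w) := by
    intro w hw
    rw [← Real.log_div (by positivity) (by positivity)]
    congr 1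
    field_simp
    ring
  have h := antitoneOn_log_sub_exp_mul_Gamma0 (Set.mem_Ioi.2 (one_div_pos.2 hy0))
    (Set.mem_Ioi.2 (one_div_pos.2 hx0)) (one_div_le_one_div_of_le hx0 hxy)
  simpa only [hlog x hx0, hlog y hy0] using h
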